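/- arXiv:1402.6466 — 2 statements merged into one kernel-verified Lean document; each statement's English description precedes it below -/
import Mathlib

section
/- Let 0 < c1 ≤ c2 be constants and let n range over an increasing sequence of integers along which c1 ≤ f(k0(n)) ≤ c2, and set μ_n = g(k0(n)). Let Y_n be the number of (k0(n)+2)-element vertex subsets of G(n,1/2) that induce a complete bipartite graph. Then |P(Y_n = 0) − e^{−μ_n}| → 0 as n → ∞. -/
open MeasureTheory ProbabilityTheory Filter Real

namespace RandomBipartiteDecomposition

/-- The set of edges of the complete bipartite graph with vertex classes `A` and `B`. -/
def bicliqueEdges {V : Type*} (A B : Finset V) : Set (Sym2 V) :=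
  {e | ∃ a ∈ A, ∃ b ∈ B, e = s(a, b)}

/-- `A`, `B` are the vertex classes of a complete bipartite subgraph of `G`. -/
def IsBicliqueIn {V : Type*} (G : SimpleGraph V) (A B : Finset V) : Prop :=
  A.Nonempty ∧ B.Nonempty ∧ Disjoint A B ∧ ∀ a ∈ A, ∀ b ∈ B, G.Adj a b

/-- A complete bipartite subgraph is nontrivial if both classes have at least 2 vertices. -/
def IsNontrivialBicliqueIn {V : Type*} (G : SimpleGraph V) (A B : Finset V) : Prop :=
  2 ≤ A.card ∧ 2 ≤ B.card ∧ Disjoint A B ∧ ∀ a ∈ A, ∀ b ∈ B, G.Adj a b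

/-- `P` lists `m` pairwise edge-disjoint complete bipartite subgraphs of `G` such that
every edge of `G` belongs to exactly one of them. -/
def IsBicliqueDecomp {V : Type*} (G : SimpleGraph V) (m : ℕ)
    (P : Fin m → Finset V × Finset V) : Prop :=
  (∀ i, IsBicliqueIn G (P i).1 (P i).2) ∧
  (∀ i j, i ≠ j →
    Disjoint (bicliqueEdges (P i).1 (P i).2) (bicliqueEdges (P j).1 (P j).2)) ∧
  (⋃ i, bicliqueEdges (P i).1 (P i).2) = G.edgeSet

/-- As above but with all complete bipartite subgraphs nontrivial. -/
def IsNontrivialBicliqueDecomp {V : Type*} (G : SimpleGraph V) (m : ℕ)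
    (P : Fin m → Finset V × Finset V) : Prop :=
  (∀ i, IsNontrivialBicliqueIn G (P i).1 (P i).2) ∧
  (∀ i j, i ≠ j →
    Disjoint (bicliqueEdges (P i).1 (P i).2) (bicliqueEdges (P j).1 (P j).2)) ∧
  (⋃ i, bicliqueEdges (P i).1 (P i).2) = G.edgeSet

/-- `τ(G)`: the minimum number of pairwise edge-disjoint complete bipartite subgraphs
of `G` so that each edge of `G` belongs to exactly one of them. -/
noncomputable def tau {V : Type*} (G : SimpleGraph V) : ℕ :=
  sInf {m | ∃ P : Fin m → Finset V × Finset V, IsBicliqueDecomp G m P}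

/-- `τ'(G)`: the minimum number of pairwise edge-disjoint *nontrivial* complete bipartite
subgraphs of `G` covering all edges of `G`; `⊤` if there is no such cover. -/
noncomputable def tau' {V : Type*} (G : SimpleGraph V) : ℕ∞ :=
  sInf {t : ℕ∞ | ∃ m : ℕ, t = m ∧ ∃ P : Fin m → Finset V × Finset V,
    IsNontrivialBicliqueDecomp G m P}

/-- `S` is an independent set of `G`. -/
def IsIndepFinset {V : Type*} (G : SimpleGraph V) (S : Finset V) : Prop :=
  ∀ a ∈ S, ∀ b ∈ S, ¬ G.Adj a b

/-- `α(G)`: the maximum size of an independent set of `G`. -/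
noncomputable def alpha {V : Type*} (G : SimpleGraph V) : ℕ :=
  sSup {k | ∃ S : Finset V, S.card = k ∧ IsIndepFinset G S}

/-- `S` induces in `G` a complete bipartite graph with nonempty vertex classes `A`, `B`. -/
def IsInducedCompleteBipartite {V : Type*} (G : SimpleGraph V) (S A B : Finset V) : Prop :=
  A.Nonempty ∧ B.Nonempty ∧ Disjoint A B ∧ (A : Set V) ∪ (B : Set V) = (S : Set V) ∧
  ∀ u ∈ S, ∀ v ∈ S, (G.Adj u v ↔ ((u ∈ A ∧ v ∈ B) ∨ (u ∈ B ∧ v ∈ A)))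

/-- `β(G)`: the largest number of vertices of an induced complete bipartite subgraph. -/
noncomputable def beta {V : Type*} (G : SimpleGraph V) : ℕ :=
  sSup {k | ∃ S A B : Finset V, IsInducedCompleteBipartite G S A B ∧ S.card = k}

/-- The Bernoulli measure on `Bool` giving `true` probability `p`. -/
noncomputable def bernoulliBool (p : ℝ) : Measure Bool :=
  p.toNNReal • Measure.dirac true + (1 - p).toNNReal • Measure.dirac false

instance (p : ℝ) : IsFiniteMeasure (bernoulliBool p) := by
  unfold bernoulliBool; infer_instance

/-- The Erdős–Rényi random graph `G(n,p)`: each unordered pair of vertices flips an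
independent `p`-coin. Events about the graph are subsets of the coin-flip space. -/
noncomputable def erdosRenyi (n : ℕ) (p : ℝ) : Measure (Sym2 (Fin n) → Bool) :=
  Measure.pi fun _ => bernoulliBool p

/-- The simple graph determined by the coin flips `ω`. -/
def graphOf (n : ℕ) (ω : Sym2 (Fin n) → Bool) : SimpleGraph (Fin n) :=
  SimpleGraph.fromEdgeSet {e | ω e = true}

/-- `f(k) = C(n,k) · 2^{-C(k,2)}`, the expected number of independent sets of size `k`
in `G(n,1/2)`. -/
noncomputable def f (n k : ℕ) : ℝ :=
  (n.choose k : ℝ) * (2 : ℝ) ^ (-(k.choose 2 : ℤ))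

/-- `k₀(n)`: the largest `k` with `f(k) ≥ 1`. -/
noncomputable def k0 (n : ℕ) : ℕ := sSup {k | 1 ≤ f n k}

/-- `g(k) = C(n,k+2) · (2^{k+1} - 1) · 2^{-C(k+2,2)}`, the expected number of induced
complete bipartite subgraphs on `k+2` vertices in `G(n,1/2)`. -/
noncomputable def g (n k : ℕ) : ℝ :=
  (n.choose (k + 2) : ℝ) * ((2 : ℝ) ^ (k + 1) - 1) * (2 : ℝ) ^ (-((k + 2).choose 2 : ℤ))

/-- The number of independent sets of size `k` in the graph determined by `ω`. -/
noncomputable def numIndep (n k : ℕ) (ω : Sym2 (Fin n) → Bool) : ℕ :=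
  Set.ncard {S : Finset (Fin n) | S.card = k ∧ IsIndepFinset (graphOf n ω) S}

/-- The number of `m`-element vertex subsets inducing a complete bipartite graph in the
graph determined by `ω`. -/
noncomputable def numBip (n m : ℕ) (ω : Sym2 (Fin n) → Bool) : ℕ :=
  Set.ncard {S : Finset (Fin n) | S.card = m ∧
    ∃ A B : Finset (Fin n), IsInducedCompleteBipartite (graphOf n ω) S A B}

theorem abs_pow_sub_pow_le_of_mem_Icc {x : ℝ} (h0 : 0 ≤ x) (h1 : x ≤ 1) (a d : ℕ) :
    |x ^ a - x ^ (a + d)| ≤ d := by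
  have ha : x ^ a ≤ 1 := pow_le_one₀ h0 h1
  have ha0 : 0 ≤ x ^ a := by positivity
  rcases Nat.eq_zero_or_pos d with rfl | hd
  · simp
  · have hd1 : (1 : ℝ) ≤ d := by exact_mod_cast hd
    have hb : x ^ (a + d) ≤ 1 := pow_le_one₀ h0 h1
    have hb0 : 0 ≤ x ^ (a + d) := by positivity
    rw [abs_le]; constructor <;> linarith

/-- **Poisson approximation at zero.** For 0/1-valued variables `X α` on a finite probability
space with weights `w`, where `X α` is independent of the sum of the variables outside its
neighbourhood `D α`, the probability that all variables vanish is within the usual Chen–Stein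
error of `exp (-λ)`. -/
theorem abs_weight_zero_sub_exp_le {Ω ι : Type*} [Fintype Ω] [DecidableEq ι]
    (w : Ω → ℝ) (hw : ∀ ω, 0 ≤ w ω) (hw1 : ∑ ω, w ω = 1)
    (I : Finset ι) (X : ι → Ω → ℕ) (hX : ∀ α ω, X α ω ≤ 1)
    (D : ι → Finset ι) (hD : ∀ α ∈ I, D α ⊆ I) (hself : ∀ α ∈ I, α ∈ D α)
    (hind : ∀ α ∈ I, ∀ x : ℝ, ∑ ω, w ω * (X α ω * x ^ (∑ β ∈ I \ D α, X β ω)) =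
      (∑ ω, w ω * X α ω) * ∑ ω, w ω * x ^ (∑ β ∈ I \ D α, X β ω)) :
    |∑ ω with ∑ α ∈ I, X α ω = 0, w ω - exp (-∑ α ∈ I, ∑ ω, w ω * X α ω)| ≤
      ∑ α ∈ I, ((∑ ω, w ω * X α ω) * (∑ β ∈ D α, ∑ ω, w ω * X β ω) +
        ∑ β ∈ (D α).erase α, ∑ ω, w ω * (X α ω * X β ω)) := by
  set K := ∑ α ∈ I, ((∑ ω, w ω * X α ω) * (∑ β ∈ D α, ∑ ω, w ω * X β ω) +
        ∑ β ∈ (D α).erase α, ∑ ω, w ω * ((X α ω : ℝ) * X β ω)) with hK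
  set lam := ∑ α ∈ I, ∑ ω, w ω * (X α ω : ℝ) with hlam
  set W : Ω → ℕ := fun ω => ∑ α ∈ I, X α ω with hW
  have hlam0 : 0 ≤ lam :=
    Finset.sum_nonneg fun α _ => Finset.sum_nonneg fun ω _ => mul_nonneg (hw ω) (by positivity)
  have hderiv : ∀ x : ℝ, HasDerivAt (fun y : ℝ => (∑ ω, w ω * y ^ W ω) * exp (-lam * y))
      ((∑ ω, w ω * (W ω * x ^ (W ω - 1))) * exp (-lam * x) +
        (∑ ω, w ω * x ^ W ω) * (exp (-lam * x) * -lam)) x := by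
    intro x
    refine HasDerivAt.mul ?_ ?_
    · refine HasDerivAt.fun_sum fun ω _ => ?_
      exact (hasDerivAt_pow (W ω) x).const_mul (w ω)
    · have := ((hasDerivAt_id x).const_mul (-lam)).exp
      simpa using this
  have hbound : ∀ x ∈ Set.Icc (0 : ℝ) 1,
      ‖(∑ ω, w ω * (W ω * x ^ (W ω - 1))) * exp (-lam * x) +
        (∑ ω, w ω * x ^ W ω) * (exp (-lam * x) * -lam)‖ ≤ K := by
    rintro x ⟨h0, h1⟩
    have hexp : exp (-lam * x) ≤ 1 := by
      rw [exp_le_one_iff]; nlinarith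
    have hsplit : (∑ ω, w ω * (W ω * x ^ (W ω - 1))) - lam * ∑ ω, w ω * x ^ W ω =
        ∑ α ∈ I, (∑ ω, w ω * (X α ω * (x ^ (W ω - 1) - x ^ (∑ β ∈ I \ D α, X β ω))) +
          (∑ ω, w ω * X α ω) * ∑ ω, w ω * (x ^ (∑ β ∈ I \ D α, X β ω) - x ^ W ω)) := by
      have e1 : (∑ ω, w ω * (W ω * x ^ (W ω - 1))) =
          ∑ α ∈ I, ∑ ω, w ω * (X α ω * x ^ (W ω - 1)) := by
        rw [Finset.sum_comm]
        refine Finset.sum_congr rfl fun ω _ => ?_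
        rw [← Finset.mul_sum, ← Finset.sum_mul, hW]
        push_cast; rfl
      rw [e1, hlam, Finset.sum_mul, ← Finset.sum_sub_distrib]
      refine Finset.sum_congr rfl fun α hα => ?_
      have := hind α hα x
      simp only [mul_sub, Finset.sum_sub_distrib]
      rw [this]; ring
    have habs : |(∑ ω, w ω * (W ω * x ^ (W ω - 1))) - lam * ∑ ω, w ω * x ^ W ω| ≤ K := by
      rw [hsplit, hK]
      refine (Finset.abs_sum_le_sum_abs _ _).trans (Finset.sum_le_sum fun α hα => ?_)
      have hWV : ∀ ω, W ω = ∑ β ∈ I \ D α, X β ω + ∑ β ∈ D α, X β ω := fun ω =>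
        (Finset.sum_sdiff (hD α hα)).symm
      have hDa : ∀ ω, ∑ β ∈ D α, X β ω = X α ω + ∑ β ∈ (D α).erase α, X β ω := fun ω =>
        (Finset.add_sum_erase _ _ (hself α hα)).symm
      have hp : 0 ≤ ∑ ω, w ω * (X α ω : ℝ) :=
        Finset.sum_nonneg fun ω _ => mul_nonneg (hw ω) (by positivity)
      refine (abs_add_le _ _).trans ?_
      rw [add_comm]
      refine add_le_add ?_ ?_
      · rw [abs_mul, abs_of_nonneg hp]
        refine mul_le_mul_of_nonneg_left ?_ hp
        rw [Finset.sum_comm]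
        refine (Finset.abs_sum_le_sum_abs _ _).trans (Finset.sum_le_sum fun ω _ => ?_)
        rw [abs_mul, abs_of_nonneg (hw ω), ← Finset.mul_sum]
        refine mul_le_mul_of_nonneg_left ?_ (hw ω)
        rw [hWV ω]
        exact (abs_pow_sub_pow_le_of_mem_Icc h0 h1 _ _).trans (by push_cast; rfl)
      · rw [Finset.sum_comm]
        refine (Finset.abs_sum_le_sum_abs _ _).trans (Finset.sum_le_sum fun ω _ => ?_)
        rw [abs_mul, abs_of_nonneg (hw ω), ← Finset.mul_sum, ← Finset.mul_sum]
        refine mul_le_mul_of_nonneg_left ?_ (hw ω)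
        rw [abs_mul, Nat.abs_cast]
        rcases Nat.le_one_iff_eq_zero_or_eq_one.1 (hX α ω) with h | h
        · simp [h]
        · refine mul_le_mul_of_nonneg_left ?_ (by positivity)
          have : W ω - 1 = ∑ β ∈ I \ D α, X β ω + ∑ β ∈ (D α).erase α, X β ω := by
            rw [hWV, hDa, h]; omega
          rw [this, abs_sub_comm]
          exact (abs_pow_sub_pow_le_of_mem_Icc h0 h1 _ _).trans (by push_cast; rfl)
    have : (∑ ω, w ω * (W ω * x ^ (W ω - 1))) * exp (-lam * x) +
        (∑ ω, w ω * x ^ W ω) * (exp (-lam * x) * -lam) =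
        ((∑ ω, w ω * (W ω * x ^ (W ω - 1))) - lam * ∑ ω, w ω * x ^ W ω) * exp (-lam * x) := by
      ring
    rw [this, norm_mul, norm_eq_abs, norm_eq_abs, abs_of_pos (exp_pos _)]
    exact (mul_le_of_le_one_right (abs_nonneg _) hexp).trans habs
  have hmv := (convex_Icc (0 : ℝ) 1).norm_image_sub_le_of_norm_hasDerivWithin_le
    (fun x _ => (hderiv x).hasDerivWithinAt) hbound
    (Set.right_mem_Icc.2 zero_le_one) (Set.left_mem_Icc.2 zero_le_one)
  have hz : ∑ ω, w ω * (0 : ℝ) ^ W ω = ∑ ω with W ω = 0, w ω := by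
    rw [Finset.sum_filter]
    refine Finset.sum_congr rfl fun ω _ => ?_
    by_cases h : W ω = 0 <;> simp [h]
  simpa only [hz, one_pow, mul_one, hw1, mul_zero, exp_zero, one_mul, norm_eq_abs, zero_sub,
    abs_neg, abs_one] using hmv

section Graph

/-- The pairs of distinct elements of `S`. -/
def pairsOf {V : Type*} [DecidableEq V] (S : Finset V) : Finset (Sym2 V) :=
  S.offDiag.image (Function.uncurry Sym2.mk)

/-- The indicator of the edges between `B` and its complement. -/
def cutIndicator {V : Type*} [DecidableEq V] (B : Finset V) : Sym2 V → Bool :=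
  Sym2.lift ⟨fun u v => decide (u ∈ B) ^^ decide (v ∈ B), fun _ _ => Bool.xor_comm _ _⟩

/-- `S` induces a complete bipartite graph in the graph determined by `ω`. -/
def InducesBip {n : ℕ} (S : Finset (Fin n)) (ω : Sym2 (Fin n) → Bool) : Prop :=
  ∃ A B : Finset (Fin n), IsInducedCompleteBipartite (graphOf n ω) S A B

/-- The coin flips agreeing with `c` on `F`. -/
def agreeOn {E : Type*} (F : Finset E) (c : E → Bool) : Set (E → Bool) :=
  {ω | ∀ e ∈ F, ω e = c e}

section pairsOf

variable {V : Type*} [DecidableEq V]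

theorem mk_mem_pairsOf {S : Finset V} {a b : V} :
    s(a, b) ∈ pairsOf S ↔ a ∈ S ∧ b ∈ S ∧ a ≠ b := by
  simp only [pairsOf, Finset.mem_image, Finset.mem_offDiag, Prod.exists, Function.uncurry]
  constructor
  · rintro ⟨x, y, ⟨hx, hy, hxy⟩, h⟩
    rcases Sym2.eq_iff.1 h with ⟨rfl, rfl⟩ | ⟨rfl, rfl⟩
    · exact ⟨hx, hy, hxy⟩
    · exact ⟨hy, hx, hxy.symm⟩
  · exact fun h => ⟨a, b, h, rfl⟩

theorem card_pairsOf (S : Finset V) : (pairsOf S).card = S.card.choose 2 :=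
  Sym2.card_image_offDiag S

theorem pairsOf_inter (S T : Finset V) : pairsOf S ∩ pairsOf T = pairsOf (S ∩ T) := by
  ext e
  induction e with | _ a b => ?_
  simp only [Finset.mem_inter, mk_mem_pairsOf]
  tauto

theorem card_pairsOf_union (S T : Finset V) :
    (pairsOf S ∪ pairsOf T).card + (S ∩ T).card.choose 2 =
      S.card.choose 2 + T.card.choose 2 := by
  rw [← card_pairsOf (S ∩ T), ← pairsOf_inter, Finset.card_union_add_card_inter, card_pairsOf,
    card_pairsOf]

theorem disjoint_pairsOf {S T : Finset V} (h : (S ∩ T).card ≤ 1) :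
    Disjoint (pairsOf S) (pairsOf T) := by
  rw [Finset.disjoint_iff_inter_eq_empty, pairsOf_inter, ← Finset.card_eq_zero, card_pairsOf]
  exact Nat.choose_eq_zero_of_lt (by omega)

@[simp] theorem cutIndicator_mk (B : Finset V) (u v : V) :
    cutIndicator B s(u, v) = (decide (u ∈ B) ^^ decide (v ∈ B)) := rfl

theorem mem_iff_of_mem_agreeOn {S B : Finset V} {v u : V} {ω : Sym2 V → Bool} (hv : v ∈ S)
    (hvB : v ∉ B) (h : ω ∈ agreeOn (pairsOf S) (cutIndicator B)) (hu : u ∈ S) (huv : u ≠ v) :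
    u ∈ B ↔ ω s(u, v) = true := by
  rw [h _ (mk_mem_pairsOf.2 ⟨hu, hv, huv⟩)]
  simp [hvB]

end pairsOf

theorem inducesBip_iff {n : ℕ} {S : Finset (Fin n)} {v : Fin n} (hv : v ∈ S)
    (ω : Sym2 (Fin n) → Bool) :
    InducesBip S ω ↔ ∃ B ∈ (S.erase v).powerset.erase ∅,
      ω ∈ agreeOn (pairsOf S) (cutIndicator B) := by
  have key : ∀ A B : Finset (Fin n), v ∈ A → IsInducedCompleteBipartite (graphOf n ω) S A B →
      ∃ B ∈ (S.erase v).powerset.erase ∅, ω ∈ agreeOn (pairsOf S) (cutIndicator B) := by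
    rintro A B hvA ⟨-, hB, hAB, hS, h⟩
    have hS' : A ∪ B = S := Finset.coe_injective (by rw [Finset.coe_union, hS])
    have hdis := Finset.disjoint_left.1 hAB
    refine ⟨B, ?_, fun e => ?_⟩
    · rw [Finset.mem_erase, Finset.mem_powerset]
      refine ⟨hB.ne_empty, fun u hu => ?_⟩
      rw [Finset.mem_erase]
      exact ⟨fun huv => hdis hvA (huv ▸ hu), hS' ▸ Finset.mem_union_right _ hu⟩
    · induction e with | _ a b => ?_
      intro he
      obtain ⟨ha, hb, hne⟩ := mk_mem_pairsOf.1 he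
      have hadj := h a ha b hb
      have hA : ∀ u ∈ S, (u ∈ A ↔ u ∉ B) := fun u hu =>
        ⟨fun h1 => hdis h1, fun h1 => by
          rw [← hS', Finset.mem_union] at hu; exact hu.resolve_right h1⟩
      rw [hA a ha, hA b hb] at hadj
      simp only [graphOf, SimpleGraph.fromEdgeSet_adj, Set.mem_ofPred_eq] at hadj
      by_cases h1 : a ∈ B <;> by_cases h2 : b ∈ B <;> simp_all
  constructor
  · rintro ⟨A, B, h⟩
    have hvS : v ∈ A ∪ B := by
      have h4 : A ∪ B = S := Finset.coe_injective (by rw [Finset.coe_union, h.2.2.2.1])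
      exact h4 ▸ hv
    rcases Finset.mem_union.1 hvS with hvA | hvB
    · exact key A B hvA h
    · refine key B A hvB ⟨h.2.1, h.1, h.2.2.1.symm, by rw [Set.union_comm]; exact h.2.2.2.1, ?_⟩
      intro a ha b hb
      rw [h.2.2.2.2 a ha b hb, or_comm]
  · rintro ⟨B, hB, h⟩
    rw [Finset.mem_erase, Finset.mem_powerset, Finset.subset_erase] at hB
    obtain ⟨hne, hBS, hvB⟩ := hB
    refine ⟨S \ B, B, ⟨v, Finset.mem_sdiff.2 ⟨hv, hvB⟩⟩, Finset.nonempty_iff_ne_empty.2 hne,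
      Finset.sdiff_disjoint, ?_, ?_⟩
    · rw [← Finset.coe_union, Finset.sdiff_union_of_subset hBS]
    · intro a ha b hb
      simp only [graphOf, SimpleGraph.fromEdgeSet_adj, Set.mem_ofPred_eq, Finset.mem_sdiff]
      by_cases hab : a = b
      · subst hab; simp; tauto
      · rw [h _ (mk_mem_pairsOf.2 ⟨ha, hb, hab⟩)]
        by_cases h1 : a ∈ B <;> by_cases h2 : b ∈ B <;> simp_all

theorem dependsOn_inducesBip {n : ℕ} (S : Finset (Fin n)) :
    DependsOn (InducesBip S) (pairsOf S : Set (Sym2 (Fin n))) := by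
  intro ω ω' h
  have key : ∀ u ∈ S, ∀ v ∈ S, ((graphOf n ω).Adj u v ↔ (graphOf n ω').Adj u v) := by
    intro u hu v hv
    by_cases huv : u = v
    · simp [huv]
    · simp [graphOf, SimpleGraph.fromEdgeSet_adj, h s(u, v) (mk_mem_pairsOf.2 ⟨hu, hv, huv⟩)]
  refine propext (exists_congr fun A => exists_congr fun B => ?_)
  unfold IsInducedCompleteBipartite
  refine and_congr_right fun _ => and_congr_right fun _ => and_congr_right fun _ =>
    and_congr_right fun _ => ?_
  exact forall₂_congr fun u hu => forall₂_congr fun v hv => by rw [key u hu v hv]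

instance : IsProbabilityMeasure (bernoulliBool (1 / 2)) := by
  refine ⟨?_⟩
  simp only [bernoulliBool, Measure.coe_add, Measure.coe_nnreal_smul_apply, Pi.add_apply,
    measure_univ, mul_one]
  rw [← ENNReal.coe_add, ← Real.toNNReal_add (by norm_num) (by norm_num)]
  norm_num

instance (n : ℕ) : IsProbabilityMeasure (erdosRenyi n (1 / 2)) := by
  unfold erdosRenyi; infer_instance

theorem bernoulliBool_half_real_singleton (b : Bool) :
    (bernoulliBool (1 / 2)).real {b} = 1 / 2 := by
  rw [measureReal_def]
  cases b <;> simp [bernoulliBool]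
  norm_num

theorem erdosRenyi_real_agreeOn {n : ℕ} (F : Finset (Sym2 (Fin n))) (c : Sym2 (Fin n) → Bool) :
    (erdosRenyi n (1 / 2)).real (agreeOn F c) = (1 / 2) ^ F.card := by
  have hset : agreeOn F c = Set.univ.pi fun e => if e ∈ F then {c e} else Set.univ := by
    ext ω
    simp only [agreeOn, Set.mem_ofPred_eq, Set.mem_univ_pi]
    refine forall_congr' fun e => ?_
    by_cases he : e ∈ F <;> simp [he]
  rw [hset, measureReal_def, erdosRenyi, Measure.pi_pi, ENNReal.toReal_prod]
  have : ∀ e, (bernoulliBool (1 / 2) (if e ∈ F then {c e} else Set.univ)).toReal =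
      if e ∈ F then (1 / 2 : ℝ) else 1 := by
    intro e
    split_ifs
    · exact bernoulliBool_half_real_singleton _
    · rw [measure_univ, ENNReal.toReal_one]
  simp only [this]
  rw [Finset.prod_ite_mem, Finset.univ_inter, Finset.prod_const]

theorem erdosRenyi_real_inducesBip {n : ℕ} {S : Finset (Fin n)} (hS : S.Nonempty) :
    (erdosRenyi n (1 / 2)).real {ω | InducesBip S ω} =
      (2 ^ (S.card - 1) - 1) * (1 / 2) ^ S.card.choose 2 := by
  obtain ⟨v, hv⟩ := hS
  have hset : {ω | InducesBip S ω} = ⋃ B ∈ (S.erase v).powerset.erase ∅,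
      agreeOn (pairsOf S) (cutIndicator B) := by
    ext ω
    simp only [Set.mem_ofPred_eq, inducesBip_iff hv, Set.mem_iUnion, exists_prop]
  rw [hset, measureReal_biUnion_finset]
  · simp only [erdosRenyi_real_agreeOn, card_pairsOf, Finset.sum_const, nsmul_eq_mul]
    rw [Finset.card_erase_of_mem (Finset.empty_mem_powerset _), Finset.card_powerset,
      Finset.card_erase_of_mem hv, Nat.cast_sub Nat.one_le_two_pow]
    push_cast; rfl
  · intro B hB B' hB' hne
    refine Set.disjoint_left.2 fun ω h h' => hne ?_
    replace hB := Finset.mem_powerset.1 (Finset.mem_of_mem_erase (Finset.mem_coe.1 hB))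
    replace hB' := Finset.mem_powerset.1 (Finset.mem_of_mem_erase (Finset.mem_coe.1 hB'))
    rw [Finset.subset_erase] at hB hB'
    ext u
    by_cases huS : u ∈ S
    · by_cases huv : u = v
      · subst huv; simp [hB.2, hB'.2]
      · rw [mem_iff_of_mem_agreeOn hv hB.2 h huS huv,
          mem_iff_of_mem_agreeOn hv hB'.2 h' huS huv]
    · exact ⟨fun h => absurd (hB.1 h) huS, fun h => absurd (hB'.1 h) huS⟩
  · exact fun _ _ => Set.Finite.measurableSet (Set.toFinite _)

theorem erdosRenyi_real_inducesBip_inter_le {n : ℕ} {S T : Finset (Fin n)}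
    (hST : (S ∩ T).Nonempty) :
    (erdosRenyi n (1 / 2)).real {ω | InducesBip S ω ∧ InducesBip T ω} ≤
      2 ^ ((S ∪ T).card - 1) * (1 / 2) ^ (pairsOf S ∪ pairsOf T).card := by
  obtain ⟨v, hv⟩ := hST
  obtain ⟨hvS, hvT⟩ := Finset.mem_inter.1 hv
  have hsub : {ω | InducesBip S ω ∧ InducesBip T ω} ⊆ ⋃ B ∈ ((S ∪ T).erase v).powerset,
      agreeOn (pairsOf S ∪ pairsOf T) (cutIndicator B) := by
    rintro ω ⟨hS, hT⟩
    obtain ⟨B, hB, h⟩ := (inducesBip_iff hvS ω).1 hS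
    obtain ⟨C, hC, h'⟩ := (inducesBip_iff hvT ω).1 hT
    simp only [Finset.mem_erase, Finset.mem_powerset, Finset.subset_erase] at hB hC
    have hagree : ∀ u ∈ S, u ∈ T → (u ∈ B ↔ u ∈ C) := by
      intro u hu hu'
      by_cases huv : u = v
      · subst huv; simp [hB.2.2, hC.2.2]
      · rw [mem_iff_of_mem_agreeOn hvS hB.2.2 h hu huv,
          mem_iff_of_mem_agreeOn hvT hC.2.2 h' hu' huv]
    have hBS : ∀ u ∈ S, (u ∈ B ∪ C ↔ u ∈ B) := fun u hu => by
      rw [Finset.mem_union]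
      exact ⟨fun h => h.elim id fun h => (hagree u hu (hC.2.1 h)).2 h, Or.inl⟩
    have hCT : ∀ u ∈ T, (u ∈ B ∪ C ↔ u ∈ C) := fun u hu => by
      rw [Finset.mem_union]
      exact ⟨fun h => h.elim (fun h => (hagree u (hB.2.1 h) hu).1 h) id, Or.inr⟩
    simp only [Set.mem_iUnion, exists_prop, Finset.mem_powerset, Finset.subset_erase]
    refine ⟨B ∪ C, ⟨Finset.union_subset_union hB.2.1 hC.2.1, ?_⟩, fun e => ?_⟩
    · rw [Finset.mem_union]; exact not_or.2 ⟨hB.2.2, hC.2.2⟩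
    · induction e with | _ a b => ?_
      intro he
      rcases Finset.mem_union.1 he with he | he
      · obtain ⟨ha, hb, -⟩ := mk_mem_pairsOf.1 he
        rw [h _ he, cutIndicator_mk, cutIndicator_mk]
        simp only [hBS a ha, hBS b hb]
      · obtain ⟨ha, hb, -⟩ := mk_mem_pairsOf.1 he
        rw [h' _ he, cutIndicator_mk, cutIndicator_mk]
        simp only [hCT a ha, hCT b hb]
  refine (measureReal_mono hsub (measure_ne_top _ _)).trans
    ((measureReal_biUnion_finset_le _ _).trans ?_)
  simp only [erdosRenyi_real_agreeOn, Finset.sum_const, nsmul_eq_mul, Finset.card_powerset]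
  rw [Finset.card_erase_of_mem (Finset.mem_union_left _ hvS)]
  push_cast; rfl

/-- Functions of disjoint sets of coordinates are uncorrelated. -/
theorem integral_mul_of_dependsOn {n : ℕ} {F H : (Sym2 (Fin n) → Bool) → ℝ}
    (A : Finset (Sym2 (Fin n))) (hF : DependsOn F (A : Set (Sym2 (Fin n))))
    (hH : DependsOn H ((Aᶜ : Finset (Sym2 (Fin n))) : Set (Sym2 (Fin n)))) :
    ∫ ω, F ω * H ω ∂erdosRenyi n (1 / 2) =
      (∫ ω, F ω ∂erdosRenyi n (1 / 2)) * ∫ ω, H ω ∂erdosRenyi n (1 / 2) := by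
  have hi : iIndepFun (fun (e : Sym2 (Fin n)) (ω : Sym2 (Fin n) → Bool) => ω e)
      (erdosRenyi n (1 / 2)) :=
    iIndepFun_pi (X := fun _ => id) fun _ => aemeasurable_id
  have h2 := hi.indepFun_finset A Aᶜ disjoint_compl_right fun e => measurable_pi_apply e
  have factor : ∀ (C : Finset (Sym2 (Fin n))) (K : (Sym2 (Fin n) → Bool) → ℝ),
      DependsOn K (C : Set (Sym2 (Fin n))) →
      ∃ φ : (C → Bool) → ℝ, K = φ ∘ fun ω (e : C) => ω e := by
    intro C K hK
    refine ⟨fun r => K fun e => if h : e ∈ C then r ⟨e, h⟩ else false, funext fun ω => ?_⟩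
    refine hK fun e he => ?_
    have he' : e ∈ C := he
    simp [he']
  obtain ⟨φ, hφ⟩ := factor A F hF
  obtain ⟨ψ, hψ⟩ := factor Aᶜ H hH
  have h3 : IndepFun F H (erdosRenyi n (1 / 2)) := by
    rw [hφ, hψ]
    exact h2.comp (measurable_of_countable φ) (measurable_of_countable ψ)
  exact h3.integral_fun_mul_eq_mul_integral
    (measurable_of_countable F).aestronglyMeasurable
    (measurable_of_countable H).aestronglyMeasurable

end Graph

section ErrorBound

open Classical in
/-- The 0/1-indicator of `InducesBip`. -/
noncomputable def bipIndicator {n : ℕ} (S : Finset (Fin n)) (ω : Sym2 (Fin n) → Bool) : ℕ :=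
  if InducesBip S ω then 1 else 0

theorem sum_real_singleton_mul {Ω : Type*} [Fintype Ω] [MeasurableSpace Ω]
    [MeasurableSingletonClass Ω] (μ : Measure Ω) [IsFiniteMeasure μ] (F : Ω → ℝ) :
    ∑ ω, μ.real {ω} * F ω = ∫ ω, F ω ∂μ :=
  (integral_fintype (Integrable.of_finite)).symm

theorem sum_real_singleton_ite {Ω : Type*} [Fintype Ω] [MeasurableSpace Ω]
    [MeasurableSingletonClass Ω] (μ : Measure Ω) [IsFiniteMeasure μ] (p : Ω → Prop)
    [DecidablePred p] : ∑ ω, μ.real {ω} * (if p ω then 1 else 0) = μ.real {ω | p ω} := by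
  simp only [mul_ite, mul_one, mul_zero]
  rw [← Finset.sum_filter, sum_measureReal_singleton]
  simp

theorem choose_succ_two (m : ℕ) : (m + 1).choose 2 = m.choose 2 + m := by
  rw [Nat.choose_succ_succ' m 1, Nat.choose_one_right, add_comm]

theorem card_filter_inter_card_le {V : Type*} [Fintype V] [DecidableEq V] (S : Finset V)
    (m i : ℕ) :
    ((Finset.powersetCard m Finset.univ).filter fun T => (S ∩ T).card = i).card ≤
      S.card.choose i * (Fintype.card V - S.card).choose (m - i) := by
  rw [← Finset.card_compl, ← Finset.card_powersetCard i S, ← Finset.card_powersetCard (m - i) Sᶜ,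
    ← Finset.card_product]
  refine Finset.card_le_card_of_injOn (fun T => (S ∩ T, T \ S)) ?_ ?_
  · intro T hT
    obtain ⟨hT, hi⟩ := Finset.mem_filter.1 (Finset.mem_coe.1 hT)
    have hm := (Finset.mem_powersetCard.1 hT).2
    simp only [Finset.coe_product, Set.mem_prod, Finset.mem_coe, Finset.mem_powersetCard]
    refine ⟨⟨Finset.inter_subset_left, hi⟩, fun x hx => ?_, ?_⟩
    · exact Finset.mem_compl.2 (Finset.mem_sdiff.1 hx).2
    · rw [Finset.card_sdiff, hi, hm]
  · intro T _ T' _ h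
    simp only [Prod.mk.injEq] at h
    rw [← Finset.sdiff_union_inter T S, ← Finset.sdiff_union_inter T' S, h.2,
      Finset.inter_comm T S, Finset.inter_comm T' S, h.1]

theorem real_inducesBip_inter_le_of_card {n k i : ℕ} {S T : Finset (Fin n)}
    (hS : S.card = k + 2) (hT : T.card = k + 2) (hi : (S ∩ T).card = i + 1) :
    (erdosRenyi n (1 / 2)).real {ω | InducesBip S ω ∧ InducesBip T ω} ≤
      (1 / 2) ^ (k + 1).choose 2 * (1 / 2) ^ (k + 1).choose 2 * 2 ^ i.choose 2 := by
  refine (erdosRenyi_real_inducesBip_inter_le (Finset.card_pos.1 (by omega))).trans_eq ?_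
  have h1 := card_pairsOf_union S T
  have h2 := Finset.card_union_add_card_inter S T
  rw [hS, hT, hi, choose_succ_two (k + 1), choose_succ_two i] at h1
  rw [hS, hT, hi] at h2
  set a := (S ∪ T).card
  set c := (pairsOf S ∪ pairsOf T).card
  have h4 : (S ∩ T).card ≤ S.card := Finset.card_le_card Finset.inter_subset_left
  have h3 : c + i.choose 2 = (k + 1).choose 2 + (k + 1).choose 2 + (a - 1) := by omega
  rw [← pow_add, one_div, inv_pow, inv_pow, ← div_eq_mul_inv, inv_mul_eq_div,
    div_eq_div_iff (by positivity) (by positivity), ← pow_add, ← pow_add]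
  congr 1; omega

theorem real_inducesBip_le {n k : ℕ} {S : Finset (Fin n)} (hS : S.card = k + 2) :
    (erdosRenyi n (1 / 2)).real {ω | InducesBip S ω} ≤ (1 / 2) ^ (k + 1).choose 2 := by
  rw [erdosRenyi_real_inducesBip (Finset.card_pos.1 (by omega)), hS, choose_succ_two (k + 1),
    pow_add, show k + 2 - 1 = k + 1 from rfl]
  have h : (2 : ℝ) ^ (k + 1) * (1 / 2) ^ (k + 1) = 1 := by rw [← mul_pow]; norm_num
  have h1 : (0 : ℝ) < (1 / 2) ^ (k + 1).choose 2 := by positivity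
  have h2 : (0 : ℝ) < (1 / 2) ^ (k + 1) := by positivity
  calc _ = (1 / 2 : ℝ) ^ (k + 1).choose 2 *
        (2 ^ (k + 1) * (1 / 2) ^ (k + 1) - (1 / 2) ^ (k + 1)) := by ring
    _ ≤ (1 / 2 : ℝ) ^ (k + 1).choose 2 * 1 := by
        rw [h]; exact mul_le_mul_of_nonneg_left (by linarith) h1.le
    _ = _ := mul_one _

theorem sum_real_inducesBip (n k : ℕ) :
    ∑ S ∈ Finset.powersetCard (k + 2) (Finset.univ : Finset (Fin n)),
      (erdosRenyi n (1 / 2)).real {ω | InducesBip S ω} = g n k := by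
  have : ∀ S ∈ Finset.powersetCard (k + 2) (Finset.univ : Finset (Fin n)),
      (erdosRenyi n (1 / 2)).real {ω | InducesBip S ω} =
      (2 ^ (k + 1) - 1) * (1 / 2) ^ (k + 2).choose 2 := by
    intro S hS
    have hS := (Finset.mem_powersetCard.1 hS).2
    rw [erdosRenyi_real_inducesBip (Finset.card_pos.1 (by omega)), hS]; rfl
  rw [Finset.sum_congr rfl this, Finset.sum_const, Finset.card_powersetCard, Finset.card_univ,
    Fintype.card_fin, nsmul_eq_mul, g, zpow_neg, zpow_natCast, one_div, inv_pow, mul_assoc]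

theorem numBip_eq_zero_iff {n m : ℕ} (ω : Sym2 (Fin n) → Bool) :
    numBip n m ω = 0 ↔
      ∑ S ∈ Finset.powersetCard m (Finset.univ : Finset (Fin n)), bipIndicator S ω = 0 := by
  rw [numBip, Set.ncard_eq_zero (Set.toFinite _), Set.eq_empty_iff_forall_notMem,
    Finset.sum_eq_zero_iff]
  refine forall_congr' fun S => ?_
  have h : bipIndicator S ω = 0 ↔ ¬InducesBip S ω := by
    unfold bipIndicator; split_ifs with h <;> simp [h]
  simp only [Set.mem_ofPred_eq, not_and, Finset.mem_powersetCard, Finset.subset_univ, true_and, h,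
    InducesBip]

/-- The Poisson approximation error in terms of the sizes `i` of the intersections of two
`(k + 2)`-sets. -/
theorem abs_prob_numBip_eq_zero_sub_exp_le (n k : ℕ) :
    |(erdosRenyi n (1 / 2)).real {ω | numBip n (k + 2) ω = 0} - exp (-g n k)| ≤
      n.choose (k + 2) * ((1 / 2) ^ (k + 1).choose 2 * (1 / 2) ^ (k + 1).choose 2 +
        2 * ∑ i ∈ Finset.Icc 1 k,
          (((k + 2).choose (i + 1) * (n - (k + 2)).choose (k + 2 - (i + 1)) : ℕ) : ℝ) *
            ((1 / 2) ^ (k + 1).choose 2 * (1 / 2) ^ (k + 1).choose 2 * 2 ^ i.choose 2)) := by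
  classical
  set μ := erdosRenyi n (1 / 2) with hμ
  set P : ℝ := (1 / 2) ^ (k + 1).choose 2 with hP
  set I := Finset.powersetCard (k + 2) (Finset.univ : Finset (Fin n)) with hI
  have hcard : ∀ S ∈ I, S.card = k + 2 := fun S hS => (Finset.mem_powersetCard.1 hS).2
  set D : Finset (Fin n) → Finset (Finset (Fin n)) := fun S => I.filter fun T =>
    2 ≤ (S ∩ T).card with hD
  have hP0 : 0 < P := by positivity
  have hX : ∀ S, ∑ ω, μ.real {ω} * (bipIndicator S ω : ℝ) = μ.real {ω | InducesBip S ω} := by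
    intro S
    rw [← sum_real_singleton_ite]
    simp [bipIndicator]
  have hXX : ∀ S T, ∑ ω, μ.real {ω} * ((bipIndicator S ω : ℝ) * bipIndicator T ω) =
      μ.real {ω | InducesBip S ω ∧ InducesBip T ω} := by
    intro S T
    rw [← sum_real_singleton_ite]
    refine Finset.sum_congr rfl fun ω _ => ?_
    by_cases h1 : InducesBip S ω <;> by_cases h2 : InducesBip T ω <;> simp [bipIndicator, h1, h2]
  have main := abs_weight_zero_sub_exp_le (fun ω => μ.real {ω}) (fun _ => measureReal_nonneg)
    (by rw [sum_measureReal_singleton]; simp) I bipIndicator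
    (fun S ω => by unfold bipIndicator; split_ifs <;> simp) D
    (fun S _ => Finset.filter_subset _ _)
    (fun S hS => Finset.mem_filter.2 ⟨hS, by rw [Finset.inter_self, hcard S hS]; omega⟩)
    (fun S hS x => by
      rw [sum_real_singleton_mul, sum_real_singleton_mul, sum_real_singleton_mul]
      refine integral_mul_of_dependsOn (pairsOf S) ?_ ?_
      · intro ω ω' h
        simp only [bipIndicator, dependsOn_inducesBip S h]
      · intro ω ω' h
        refine congrArg (x ^ ·) (Finset.sum_congr rfl fun T hT => ?_)
        have hT' : (S ∩ T).card ≤ 1 := by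
          simp only [hD, Finset.mem_sdiff, Finset.mem_filter, not_and, not_le] at hT
          have := hT.2 hT.1
          omega
        have hdep : InducesBip T ω = InducesBip T ω' := dependsOn_inducesBip T fun e he =>
          h e (Finset.mem_coe.2 (Finset.mem_compl.2 fun he' =>
            Finset.disjoint_left.1 (disjoint_pairsOf hT') he' (Finset.mem_coe.1 he)))
        simp only [bipIndicator, hdep])
  simp only [hX, hXX] at main
  rw [sum_real_inducesBip, sum_measureReal_singleton] at main
  have hzero : ((Finset.univ.filter fun ω => ∑ S ∈ I, bipIndicator S ω = 0 :
      Finset (Sym2 (Fin n) → Bool)) : Set (Sym2 (Fin n) → Bool)) =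
      {ω | numBip n (k + 2) ω = 0} := by
    ext ω
    simp only [Finset.coe_filter, Finset.mem_univ, true_and, Set.mem_ofPred_eq]
    exact (numBip_eq_zero_iff ω).symm
  rw [hzero] at main
  refine main.trans ?_
  have hIcard : I.card = n.choose (k + 2) := by simp [hI]
  rw [← hIcard, ← nsmul_eq_mul]
  refine Finset.sum_le_card_nsmul _ _ _ fun S hS => ?_
  have hSD : S ∈ D S := Finset.mem_filter.2
    ⟨hS, by rw [Finset.inter_self, hcard S hS]; omega⟩
  have hp : ∀ T ∈ I, μ.real {ω | InducesBip T ω} ≤ P := fun T hT => real_inducesBip_le (hcard T hT)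
  have hmem : ∀ T ∈ (D S).erase S, T ∈ I ∧ (S ∩ T).card - 1 ∈ Finset.Icc 1 k ∧
      (S ∩ T).card = (S ∩ T).card - 1 + 1 := by
    intro T hT
    obtain ⟨hne, hT⟩ := Finset.mem_erase.1 hT
    obtain ⟨hTI, h2⟩ := Finset.mem_filter.1 hT
    have hlt : (S ∩ T).card < k + 2 := by
      rw [← hcard S hS]
      refine Finset.card_lt_card (Finset.inter_subset_left.ssubset_of_ne fun h => hne ?_)
      exact (Finset.eq_of_subset_of_card_le (Finset.inter_eq_left.1 h)
        (by rw [hcard S hS, hcard T hTI])).symm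
    rw [Finset.mem_Icc]
    exact ⟨hTI, by omega, by omega⟩
  have hsum : ∑ T ∈ (D S).erase S, P * P * 2 ^ ((S ∩ T).card - 1).choose 2 ≤
      ∑ i ∈ Finset.Icc 1 k,
          (((k + 2).choose (i + 1) * (n - (k + 2)).choose (k + 2 - (i + 1)) : ℕ) : ℝ) *
            (P * P * 2 ^ i.choose 2) := by
    rw [← Finset.sum_fiberwise_of_maps_to (g := fun T => (S ∩ T).card - 1)
      (fun T hT => (hmem T hT).2.1)]
    refine Finset.sum_le_sum fun i _ => ?_
    rw [Finset.sum_congr rfl (g := fun _ => P * P * 2 ^ i.choose 2)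
      (fun T hT => by rw [(Finset.mem_filter.1 hT).2]), Finset.sum_const, nsmul_eq_mul]
    refine mul_le_mul_of_nonneg_right ?_ (by positivity)
    rw [Nat.cast_le, ← hcard S hS]
    refine le_trans ?_ ((card_filter_inter_card_le S S.card (i + 1)).trans_eq (by simp))
    refine Finset.card_le_card fun T hT => ?_
    obtain ⟨hT, hi⟩ := Finset.mem_filter.1 hT
    have := hmem T hT
    rw [Finset.mem_filter, hcard S hS]
    exact ⟨this.1, by omega⟩
  have hfirst : μ.real {ω | InducesBip S ω} * ∑ T ∈ D S, μ.real {ω | InducesBip T ω} ≤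
      P * P + ∑ T ∈ (D S).erase S, P * P * 2 ^ ((S ∩ T).card - 1).choose 2 := by
    rw [← Finset.add_sum_erase _ _ hSD, mul_add, Finset.mul_sum]
    refine add_le_add (mul_le_mul (hp S hS) (hp S hS) measureReal_nonneg hP0.le)
      (Finset.sum_le_sum fun T hT => ?_)
    refine (mul_le_mul (hp S hS) (hp T (hmem T hT).1) measureReal_nonneg hP0.le).trans ?_
    exact le_mul_of_one_le_right (by positivity) (one_le_pow₀ (by norm_num))
  have hsecond : ∑ T ∈ (D S).erase S, μ.real {ω | InducesBip S ω ∧ InducesBip T ω} ≤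
      ∑ T ∈ (D S).erase S, P * P * 2 ^ ((S ∩ T).card - 1).choose 2 :=
    Finset.sum_le_sum fun T hT =>
      real_inducesBip_inter_le_of_card (hcard S hS) (hcard T (hmem T hT).1) (hmem T hT).2.2
  linarith

end ErrorBound

section Estimates

theorem choose_mul_pow_le {m n : ℕ} (h : m ≤ n) (i : ℕ) :
    m.choose i * n ^ i ≤ n.choose i * m ^ i := by
  have hdesc : m.descFactorial i * n ^ i ≤ n.descFactorial i * m ^ i := by
    induction i with
    | zero => simp
    | succ i ih =>
      rw [Nat.descFactorial_succ, Nat.descFactorial_succ, pow_succ, pow_succ]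
      have h1 : (m - i) * n ≤ (n - i) * m := by
        rw [Nat.sub_mul, Nat.sub_mul, mul_comm n m]
        exact Nat.sub_le_sub_left (Nat.mul_le_mul_left i h) _
      calc (m - i) * m.descFactorial i * (n ^ i * n)
          = (m.descFactorial i * n ^ i) * ((m - i) * n) := by ring
        _ ≤ (n.descFactorial i * m ^ i) * ((n - i) * m) := Nat.mul_le_mul ih h1
        _ = _ := by ring
  rw [Nat.descFactorial_eq_factorial_mul_choose, Nat.descFactorial_eq_factorial_mul_choose,
    mul_assoc, mul_assoc] at hdesc
  exact Nat.le_of_mul_le_mul_left hdesc (Nat.factorial_pos i)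

theorem two_mul_choose_two (j : ℕ) : 2 * (j + 1).choose 2 = j * (j + 1) := by
  induction j with
  | zero => rfl
  | succ j ih => rw [choose_succ_two, mul_add, ih]; ring

theorem two_pow_choose_two (j : ℕ) : (2 : ℝ) ^ (j + 1).choose 2 = √2 ^ (j * (j + 1)) := by
  rw [← two_mul_choose_two, pow_mul, Real.sq_sqrt zero_le_two]

theorem one_le_sqrt_two : 1 ≤ √2 := Real.one_le_sqrt.2 one_le_two

theorem sqrt_two_le_two : √2 ≤ 2 := by
  rw [Real.sqrt_le_left zero_le_two]; norm_num

theorem f_eq (n k : ℕ) : f n k = n.choose k / 2 ^ k.choose 2 := by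
  rw [f, zpow_neg, zpow_natCast, div_eq_mul_inv]

theorem le_of_one_le_f {n k : ℕ} (h : 1 ≤ f n k) : k ≤ n := by
  by_contra! hk
  rw [f_eq, Nat.choose_eq_zero_of_lt hk] at h
  norm_num at h

theorem sqrt_two_pow_le_of_one_le_f {n j : ℕ} (h : 1 ≤ f n (j + 1)) : √2 ^ j ≤ n := by
  rw [f_eq, le_div_iff₀ (by positivity), one_mul, two_pow_choose_two, pow_mul] at h
  have h2 : ((n.choose (j + 1) : ℕ) : ℝ) ≤ (n : ℝ) ^ (j + 1) := by
    exact_mod_cast Nat.choose_le_pow n (j + 1)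
  exact (pow_le_pow_iff_left₀ (by positivity) (by positivity) (Nat.add_one_ne_zero j)).1 (h.trans h2)

theorem le_of_f_le {n j : ℕ} {c : ℝ} (h : 1 ≤ f n (j + 1)) (hc : f n (j + 1) ≤ c) :
    (n : ℝ) ≤ c * (j + 1) * √2 ^ j := by
  have hc1 : 1 ≤ c := h.trans hc
  have hjn := le_of_one_le_f h
  rw [f_eq, div_le_iff₀ (by positivity), two_pow_choose_two, pow_mul] at hc
  have h1 : (n : ℝ) ^ (j + 1) ≤ n.choose (j + 1) * (j + 1) ^ (j + 1) := by
    have := choose_mul_pow_le hjn (j + 1)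
    rw [Nat.choose_self, one_mul] at this
    exact_mod_cast this
  refine (pow_le_pow_iff_left₀ (by positivity) (by positivity) (Nat.add_one_ne_zero j)).1 (h1.trans ?_)
  rw [mul_pow, mul_pow]
  calc (n.choose (j + 1) : ℝ) * (j + 1) ^ (j + 1)
      ≤ (c * (√2 ^ j) ^ (j + 1)) * (j + 1) ^ (j + 1) := by gcongr
    _ ≤ (c ^ (j + 1) * (√2 ^ j) ^ (j + 1)) * (j + 1) ^ (j + 1) := by
        gcongr; exact le_self_pow₀ hc1 (Nat.add_one_ne_zero j)
    _ = _ := by ring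

theorem choose_add_two_mul_le {n j : ℕ} {c : ℝ} (h : 1 ≤ f n (j + 1)) (hc : f n (j + 1) ≤ c) :
    (n.choose (j + 3) : ℝ) * (1 / 2) ^ (j + 2).choose 2 ≤ c ^ 3 := by
  have hc1 : 1 ≤ c := h.trans hc
  have hn := le_of_f_le h hc
  have h1 : (n.choose (j + 3) : ℝ) * ((j + 3) * (j + 2)) ≤ n.choose (j + 1) * n ^ 2 := by
    have e1 := Nat.choose_succ_right_eq n (j + 2)
    have e2 := Nat.choose_succ_right_eq n (j + 1)
    have : n.choose (j + 3) * ((j + 3) * (j + 2)) ≤ n.choose (j + 1) * n ^ 2 := by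
      calc n.choose (j + 3) * ((j + 3) * (j + 2))
          = n.choose (j + 2 + 1) * (j + 2 + 1) * (j + 2) := by ring
        _ = n.choose (j + 1 + 1) * (j + 1 + 1) * (n - (j + 2)) := by rw [e1]; ring
        _ = n.choose (j + 1) * ((n - (j + 1)) * (n - (j + 2))) := by rw [e2]; ring
        _ ≤ n.choose (j + 1) * (n * n) := by gcongr <;> omega
        _ = _ := by ring
    exact_mod_cast this
  rw [f_eq, div_le_iff₀ (by positivity)] at hc
  have h2 : (n : ℝ) ^ 2 ≤ c ^ 2 * ((j + 3) * (j + 2)) * 2 ^ (j + 1) := by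
    calc (n : ℝ) ^ 2 ≤ (c * (j + 1) * √2 ^ j) ^ 2 := by gcongr
      _ = c ^ 2 * ((j + 1) * (j + 1)) * (√2 ^ 2) ^ j := by ring
      _ ≤ c ^ 2 * ((j + 3) * (j + 2)) * 2 ^ (j + 1) := by
          rw [Real.sq_sqrt zero_le_two]
          gcongr <;> norm_num
  rw [one_div, inv_pow, ← div_eq_mul_inv, div_le_iff₀ (by positivity), choose_succ_two (j + 1),
    pow_add]
  have h3 : (0 : ℝ) < (j + 3) * (j + 2) := by positivity
  refine le_of_mul_le_mul_right (h1.trans ?_) h3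
  calc (n.choose (j + 1) : ℝ) * n ^ 2
      ≤ (c * 2 ^ (j + 1).choose 2) * (c ^ 2 * ((j + 3) * (j + 2)) * 2 ^ (j + 1)) := by gcongr
    _ = _ := by ring

/-- The bound on the terms coming from intersections of at least half the size. -/
theorem choose_mul_choose_mul_le_of_le {n j i : ℕ} {c : ℝ} (h : 1 ≤ f n (j + 1))
    (hc : f n (j + 1) ≤ c) (hi : i + 1 ≤ j + 1) (hhalf : (j + 3) / 2 ≤ i + 2)
    (hq : 2 * c * (j + 3) ^ 2 / √2 ^ ((j + 3) / 2) ≤ 1) :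
    (((j + 3).choose (i + 2) * (n - (j + 3)).choose (j + 3 - (i + 2)) : ℕ) : ℝ) *
      ((1 / 2) ^ (j + 2).choose 2 * 2 ^ (i + 1).choose 2) ≤
      2 * c * (j + 3) ^ 2 / √2 ^ ((j + 3) / 2) := by
  have hc1 : 1 ≤ c := h.trans hc
  have hn := le_of_f_le h hc
  have ht := one_le_sqrt_two
  obtain ⟨l, rfl⟩ := Nat.exists_eq_add_of_le (Nat.le_of_succ_le_succ hi)
  have hl : i + l + 3 - (i + 2) = l + 1 := by omega
  rw [hl, ← Nat.choose_symm_of_eq_add (show i + l + 3 = (l + 1) + (i + 2) by ring)]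
  have h1 : (((i + l + 3).choose (l + 1) * (n - (i + l + 3)).choose (l + 1) : ℕ) : ℝ) ≤
      (((i + l : ℕ) : ℝ) + 3) ^ (l + 1) * (n : ℝ) ^ (l + 1) := by
    have : (i + l + 3).choose (l + 1) * (n - (i + l + 3)).choose (l + 1) ≤
        (i + l + 3) ^ (l + 1) * n ^ (l + 1) :=
      Nat.mul_le_mul (Nat.choose_le_pow _ _)
        ((Nat.choose_le_pow _ _).trans (Nat.pow_le_pow_left (Nat.sub_le _ _) _))
    exact_mod_cast this
  have h2 : ((1 : ℝ) / 2) ^ (i + l + 2).choose 2 * 2 ^ (i + 1).choose 2 =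
      1 / (√2 ^ (2 * i + l + 2)) ^ (l + 1) := by
    rw [one_div, inv_pow, inv_mul_eq_div, div_eq_div_iff (by positivity) (by positivity),
      two_pow_choose_two, two_pow_choose_two (i + l + 1), ← pow_mul, ← pow_add, one_mul]
    congr 1; ring
  set q := 2 * c * (((i + l : ℕ) : ℝ) + 3) ^ 2 / √2 ^ ((i + l + 3) / 2) with hqdef
  have h3 : (((i + l : ℕ) : ℝ) + 3) * n / √2 ^ (2 * i + l + 2) ≤ q := by
    rw [hqdef, div_le_div_iff₀ (by positivity) (by positivity)]
    have h4 : √2 ^ (i + l) * √2 ^ ((i + l + 3) / 2) ≤ √2 ^ (2 * i + l + 2) := by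
      rw [← pow_add]; exact pow_le_pow_right₀ ht (by omega)
    calc (((i + l : ℕ) : ℝ) + 3) * n * √2 ^ ((i + l + 3) / 2)
        ≤ (((i + l : ℕ) : ℝ) + 3) * (c * (((i + l : ℕ) : ℝ) + 1) * √2 ^ (i + l)) *
          √2 ^ ((i + l + 3) / 2) := by gcongr
      _ = c * ((((i + l : ℕ) : ℝ) + 3) * (((i + l : ℕ) : ℝ) + 1)) *
          (√2 ^ (i + l) * √2 ^ ((i + l + 3) / 2)) := by ring
      _ ≤ (2 * c) * ((((i + l : ℕ) : ℝ) + 3) * (((i + l : ℕ) : ℝ) + 3)) *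
          √2 ^ (2 * i + l + 2) := by
          gcongr
          · linarith
          · norm_num
      _ = _ := by ring
  rw [h2]
  calc _ ≤ ((((i + l : ℕ) : ℝ) + 3) ^ (l + 1) * (n : ℝ) ^ (l + 1)) *
        (1 / (√2 ^ (2 * i + l + 2)) ^ (l + 1)) := by gcongr
    _ = ((((i + l : ℕ) : ℝ) + 3) * n / √2 ^ (2 * i + l + 2)) ^ (l + 1) := by
        rw [div_pow, mul_pow]; ring
    _ ≤ q ^ (l + 1) := by gcongr
    _ ≤ q := pow_le_of_le_one (by positivity) hq l.succ_ne_zero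

/-- The bound on the terms coming from intersections of at most half the size. -/
theorem choose_mul_choose_mul_le_of_ge {n j i : ℕ} {c : ℝ} (h : 1 ≤ f n (j + 1))
    (hc : f n (j + 1) ≤ c) (hi : i + 1 ≤ j + 1) (hhalf : i + 2 ≤ (j + 3) / 2)
    (hq : 2 * c * (j + 3) ^ 2 / √2 ^ ((j + 3) / 2) ≤ 1) :
    (((j + 3).choose (i + 2) * (n - (j + 3)).choose (j + 3 - (i + 2)) : ℕ) : ℝ) *
      ((1 / 2) ^ (j + 2).choose 2 * 2 ^ (i + 1).choose 2) ≤
      c ^ 3 * (2 * c * (j + 3) ^ 2 / √2 ^ ((j + 3) / 2)) := by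
  have hc1 : 1 ≤ c := h.trans hc
  have hn := sqrt_two_pow_le_of_one_le_f h
  have hmu := choose_add_two_mul_le h hc
  have ht := one_le_sqrt_two
  set q := 2 * c * ((j : ℝ) + 3) ^ 2 / √2 ^ ((j + 3) / 2) with hqdef
  have hq0 : 0 ≤ q := by positivity
  rcases lt_or_ge n (j + 3) with hlt | hge
  · rw [Nat.sub_eq_zero_of_le hlt.le,
      Nat.choose_eq_zero_of_lt (show 0 < j + 3 - (i + 2) by omega)]
    simp only [mul_zero, Nat.cast_zero, zero_mul]
    positivity
  have hn0 : (0 : ℝ) < n := by exact_mod_cast (show 0 < n by omega)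
  have h1 : (((j + 3).choose (i + 2) * (n - (j + 3)).choose (j + 3 - (i + 2)) : ℕ) : ℝ) *
      (n : ℝ) ^ (i + 2) ≤ n.choose (j + 3) * (((j : ℝ) + 3) ^ 2) ^ (i + 2) := by
    have : (j + 3).choose (i + 2) * (n - (j + 3)).choose (j + 3 - (i + 2)) * n ^ (i + 2) ≤
        n.choose (j + 3) * ((j + 3) ^ 2) ^ (i + 2) := by
      calc (j + 3).choose (i + 2) * (n - (j + 3)).choose (j + 3 - (i + 2)) * n ^ (i + 2)
          = (j + 3).choose (i + 2) * n ^ (i + 2) *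
            (n - (j + 3)).choose (j + 3 - (i + 2)) := by ring
        _ ≤ n.choose (i + 2) * (j + 3) ^ (i + 2) *
            (n - (i + 2)).choose (j + 3 - (i + 2)) :=
            Nat.mul_le_mul (choose_mul_pow_le hge _) (Nat.choose_le_choose _ (by omega))
        _ = n.choose (j + 3) * (j + 3).choose (i + 2) * (j + 3) ^ (i + 2) := by
            rw [Nat.choose_mul (by omega : i + 2 ≤ j + 3)]; ring
        _ ≤ n.choose (j + 3) * (j + 3) ^ (i + 2) * (j + 3) ^ (i + 2) := by
            gcongr; exact Nat.choose_le_pow _ _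
        _ = _ := by rw [← pow_mul, two_mul, pow_add]; ring
    exact_mod_cast this
  have h2 : (2 : ℝ) ^ (i + 1).choose 2 ≤ (√2 ^ i) ^ (i + 2) := by
    rw [two_pow_choose_two, ← pow_mul]
    exact pow_le_pow_right₀ ht (Nat.mul_le_mul_left _ (by omega))
  have h3 : ((j : ℝ) + 3) ^ 2 * √2 ^ i / n ≤ q := by
    rw [hqdef, div_le_div_iff₀ hn0 (by positivity)]
    have h4 : √2 ^ i * √2 ^ ((j + 3) / 2) ≤ 2 * √2 ^ j := by
      calc √2 ^ i * √2 ^ ((j + 3) / 2) ≤ √2 ^ (j + 1) := by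
            rw [← pow_add]; exact pow_le_pow_right₀ ht (by omega)
        _ = √2 * √2 ^ j := pow_succ' _ _
        _ ≤ 2 * √2 ^ j := by gcongr; exact sqrt_two_le_two
    calc ((j : ℝ) + 3) ^ 2 * √2 ^ i * √2 ^ ((j + 3) / 2)
        = 1 * ((j : ℝ) + 3) ^ 2 * (√2 ^ i * √2 ^ ((j + 3) / 2)) := by ring
      _ ≤ c * ((j : ℝ) + 3) ^ 2 * (2 * n) :=
          mul_le_mul (by gcongr) (h4.trans (by gcongr)) (by positivity) (by positivity)
      _ = _ := by ring
  rw [← le_div_iff₀ (by positivity)] at h1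
  calc _ ≤ (n.choose (j + 3) * (((j : ℝ) + 3) ^ 2) ^ (i + 2) / (n : ℝ) ^ (i + 2)) *
        ((1 / 2) ^ (j + 2).choose 2 * (√2 ^ i) ^ (i + 2)) := by gcongr
    _ = (n.choose (j + 3) * (1 / 2) ^ (j + 2).choose 2) *
        (((j : ℝ) + 3) ^ 2 * √2 ^ i / n) ^ (i + 2) := by
        rw [div_pow (_ * _), mul_pow]; ring
    _ ≤ c ^ 3 * q ^ (i + 2) := by gcongr
    _ ≤ c ^ 3 * q := by
        gcongr
        exact pow_le_of_le_one hq0 hq (i + 1).succ_ne_zero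

theorem abs_prob_numBip_eq_zero_sub_exp_le_of_f_le {n j : ℕ} {c : ℝ} (h : 1 ≤ f n (j + 1))
    (hc : f n (j + 1) ≤ c) (hq : 2 * c * (j + 3) ^ 2 / √2 ^ ((j + 3) / 2) ≤ 1) :
    |(erdosRenyi n (1 / 2)).real {ω | numBip n (j + 1 + 2) ω = 0} - exp (-g n (j + 1))| ≤
      c ^ 3 * ((1 + 2 * ((j + 1) * (1 + c ^ 3))) *
        (2 * c * (j + 3) ^ 2 / √2 ^ ((j + 3) / 2))) := by
  have hc1 : 1 ≤ c := h.trans hc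
  have hmu := choose_add_two_mul_le h hc
  refine (abs_prob_numBip_eq_zero_sub_exp_le n (j + 1)).trans ?_
  set q := 2 * c * ((j : ℝ) + 3) ^ 2 / √2 ^ ((j + 3) / 2) with hqdef
  have hq0 : 0 ≤ q := by positivity
  set P : ℝ := (1 / 2) ^ (j + 2).choose 2 with hP
  have hPq : P ≤ q := by
    rw [hP, one_div, inv_pow, two_pow_choose_two, inv_eq_one_div, hqdef]
    refine div_le_div₀ (by positivity) ?_ (by positivity)
      (pow_le_pow_right₀ one_le_sqrt_two ?_)
    · nlinarith [(Nat.cast_nonneg j : (0 : ℝ) ≤ j)]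
    · have : (j + 3) / 2 ≤ j + 1 + 1 := by omega
      nlinarith
  have hterm : ∀ i ∈ Finset.Icc 1 (j + 1),
      (((j + 3).choose (i + 1) * (n - (j + 3)).choose (j + 3 - (i + 1)) : ℕ) : ℝ) *
        (P * 2 ^ i.choose 2) ≤ (1 + c ^ 3) * q := by
    intro i hi
    obtain ⟨hi1, hi2⟩ := Finset.mem_Icc.1 hi
    obtain ⟨i, rfl⟩ := Nat.exists_eq_add_of_le' hi1
    have hcq : 0 ≤ c ^ 3 * q := by positivity
    rcases le_total ((j + 3) / 2) (i + 2) with hh | hh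
    · have := choose_mul_choose_mul_le_of_le h hc hi2 hh hq
      refine this.trans ?_
      linarith
    · have := choose_mul_choose_mul_le_of_ge h hc hi2 hh hq
      refine this.trans ?_
      linarith
  have hsum := Finset.sum_le_card_nsmul _ _ _ hterm
  rw [Nat.card_Icc, nsmul_eq_mul, Nat.add_sub_cancel] at hsum
  push_cast at hsum
  calc _ = (n.choose (j + 3) * P) * (P + 2 * ∑ i ∈ Finset.Icc 1 (j + 1),
        (((j + 3).choose (i + 1) * (n - (j + 3)).choose (j + 3 - (i + 1)) : ℕ) : ℝ) *
          (P * 2 ^ i.choose 2)) := by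
        have e : ∀ x y : ℝ, x * (P * P * y) = P * (x * (P * y)) := fun x y => by ring
        simp only [e]
        rw [← Finset.mul_sum]; ring
    _ ≤ c ^ 3 * (q + 2 * ((j + 1) * ((1 + c ^ 3) * q))) := by
        push_cast
        gcongr
    _ = _ := by ring

theorem tendsto_pow_div_sqrt_two_pow (p : ℕ) :
    Tendsto (fun j : ℕ => ((j : ℝ) + 3) ^ p / √2 ^ ((j + 3) / 2)) atTop (nhds 0) := by
  have h1 : 1 < √2 := by rw [Real.lt_sqrt zero_le_one]; norm_num
  have hdiv : Tendsto (fun j : ℕ => (j + 3) / 2) atTop atTop :=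
    tendsto_atTop_atTop.2 fun b => ⟨2 * b, fun j hj => by omega⟩
  have h2 := ((tendsto_pow_const_div_const_pow_of_one_lt p h1).comp hdiv).const_mul ((3 : ℝ) ^ p)
  rw [mul_zero] at h2
  refine squeeze_zero (fun j => by positivity) (fun j => ?_) h2
  rw [Function.comp_apply, ← mul_div_assoc, ← mul_pow]
  have : (j : ℝ) + 3 ≤ 3 * ((j + 3) / 2 : ℕ) := by
    exact_mod_cast (show j + 3 ≤ 3 * ((j + 3) / 2) by omega)
  gcongr

theorem bddAbove_one_le_f (n : ℕ) : BddAbove {k | 1 ≤ f n k} :=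
  ⟨n, fun _ hk => le_of_one_le_f hk⟩

theorem one_le_f_k0 (n : ℕ) : 1 ≤ f n (k0 n) :=
  Nat.sSup_mem ⟨0, by simp [f]⟩ (bddAbove_one_le_f n)

theorem one_le_k0 {n : ℕ} (hn : 1 ≤ n) : 1 ≤ k0 n :=
  le_csSup (bddAbove_one_le_f n) (by simpa [f] using hn)

theorem tendsto_k0_sub_one {s : ℕ → ℕ} {c : ℝ} (hs : Tendsto s atTop atTop)
    (hc : ∀ j, f (s j) (k0 (s j)) ≤ c) : Tendsto (fun j => k0 (s j) - 1) atTop atTop := by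
  refine tendsto_atTop.2 fun K => ?_
  obtain ⟨N, hN⟩ := exists_nat_gt (c * (K + 1) * √2 ^ K)
  filter_upwards [hs.eventually_ge_atTop (N + 1)] with j hj
  by_contra! hlt
  obtain ⟨k, hk⟩ := Nat.exists_eq_add_of_le' (one_le_k0 (show 1 ≤ s j by omega))
  have h1 := one_le_f_k0 (s j)
  have h2 := hc j
  rw [hk] at h1 h2 hlt
  have hkK : k ≤ K := by omega
  have hc1 : 1 ≤ c := h1.trans h2
  have hle : (s j : ℝ) ≤ c * (K + 1) * √2 ^ K :=
    (le_of_f_le h1 h2).trans (by gcongr; exact one_le_sqrt_two)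
  have : (N : ℝ) + 1 ≤ s j := by exact_mod_cast hj
  linarith

end Estimates

/-- along a sequence with `c1 ≤ f(k₀) ≤ c2` and `μ = g(k₀)`, the number `Y`
of `(k₀+2)`-subsets of `G(n,1/2)` inducing a complete bipartite graph satisfies
`|P(Y = 0) - e^{-μ}| → 0`. -/
theorem poisson_approx_bip
    (c1 c2 : ℝ) (hc1 : 0 < c1) (hc12 : c1 ≤ c2)
    (s : ℕ → ℕ) (hs : StrictMono s)
    (hf : ∀ j, c1 ≤ f (s j) (k0 (s j)) ∧ f (s j) (k0 (s j)) ≤ c2) :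
    Tendsto (fun j =>
      |(erdosRenyi (s j) (1/2) {ω | numBip (s j) (k0 (s j) + 2) ω = 0}).toReal -
        Real.exp (-(g (s j) (k0 (s j))))|) atTop (nhds 0) := by
  have hk := tendsto_k0_sub_one hs.tendsto_atTop fun j => (hf j).2
  have hq : Tendsto (fun j : ℕ => 2 * c2 * ((j : ℝ) + 3) ^ 2 / √2 ^ ((j + 3) / 2)) atTop
      (nhds 0) := by
    simpa only [mul_div_assoc, mul_zero] using (tendsto_pow_div_sqrt_two_pow 2).const_mul (2 * c2)
  have hlim : Tendsto (fun j : ℕ => c2 ^ 3 * ((1 + 2 * (((j : ℝ) + 3) * (1 + c2 ^ 3))) *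
      (2 * c2 * ((j : ℝ) + 3) ^ 2 / √2 ^ ((j + 3) / 2)))) atTop (nhds 0) := by
    have h3 := ((tendsto_pow_div_sqrt_two_pow 3).const_mul (2 * (1 + c2 ^ 3) * (2 * c2))).add hq
    have h4 := h3.const_mul (c2 ^ 3)
    rw [mul_zero, add_zero, mul_zero] at h4
    refine h4.congr fun j => ?_
    ring
  refine squeeze_zero' (Eventually.of_forall fun j => abs_nonneg _) ?_ (hlim.comp hk)
  filter_upwards [(hq.comp hk).eventually_le_const zero_lt_one,
    hs.tendsto_atTop.eventually_ge_atTop 1] with j hj hsj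
  obtain ⟨k, hk0⟩ := Nat.exists_eq_add_of_le' (one_le_k0 hsj)
  have h1 := one_le_f_k0 (s j)
  have h2 := (hf j).2
  simp only [Function.comp_apply, hk0, Nat.add_sub_cancel] at hj h1 h2 ⊢
  have hc1 : 1 ≤ c2 := h1.trans h2
  refine (abs_prob_numBip_eq_zero_sub_exp_le_of_f_le h1 h2 hj).trans ?_
  gcongr
  norm_num

end RandomBipartiteDecomposition
end

section
/- There are absolute positive constants a, c and C such that for all sufficiently large n and every positive real p ≤ c satisfying np ≥ C·log₂ n, the probability that G = G(n,p) contains a collection of at most 2n pairwise edge-disjoint nontrivial complete bipartite subgraphs whose union covers at least pn²/4 edges of G is at most 2^{−a·p·log₂(1/p)·n²}. -/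
open MeasureTheory ProbabilityTheory Filter Real

namespace RandomBipartiteDecomposition

theorem ncard_bicliqueEdges {V : Type*} {A B : Finset V} (h : Disjoint A B) :
    (bicliqueEdges A B).ncard = A.card * B.card := by
  have himage : bicliqueEdges A B =
      (fun x : V × V => s(x.1, x.2)) '' (A ×ˢ B : Finset (V × V)) := by
    ext e
    simp [bicliqueEdges, eq_comm, and_assoc]
  rw [himage, Set.InjOn.ncard_image, Set.ncard_coe_finset, Finset.card_product]
  rintro ⟨a, b⟩ hab ⟨a', b'⟩ hab' heq
  simp only [Finset.coe_product, Set.mem_prod, Finset.mem_coe] at hab hab'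
  rcases Sym2.eq_iff.1 heq with ⟨h1, h2⟩ | ⟨h1, -⟩
  · exact Prod.ext h1 h2
  · exact absurd (show a = b' from h1) (Finset.disjoint_iff_ne.1 h a hab.1 b' hab'.2)

/-- The probability that all the pairs in `F` are edges. -/
theorem erdosRenyi_real_forall_mem {n : ℕ} {p : ℝ} (h0 : 0 ≤ p) (h1 : p ≤ 1)
    (F : Set (Sym2 (Fin n))) :
    (erdosRenyi n p).real {ω | ∀ e ∈ F, ω e = true} = p ^ F.ncard := by
  classical
  have hbox : {ω : Sym2 (Fin n) → Bool | ∀ e ∈ F, ω e = true} =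
      Set.pi Set.univ fun e => if e ∈ F then {true} else Set.univ := by
    ext ω
    simp only [Set.mem_ofPred_eq, Set.mem_pi, Set.mem_univ, true_imp_iff]
    refine forall_congr' fun e => ?_
    by_cases he : e ∈ F <;> simp [he]
  have hval : ∀ e, bernoulliBool p (if e ∈ F then {true} else Set.univ) =
      if e ∈ F then ENNReal.ofReal p else 1 := by
    intro e
    by_cases he : e ∈ F
    · simp only [he, if_true, bernoulliBool, Measure.add_apply, Measure.smul_apply,
        ENNReal.smul_def, smul_eq_mul, ENNReal.ofReal]
      simp
    · simp only [he, if_false, bernoulliBool, Measure.add_apply, Measure.smul_apply,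
        measure_univ, ENNReal.smul_def, smul_eq_mul, mul_one]
      rw [← ENNReal.coe_add, ← Real.toNNReal_add h0 (by linarith)]
      simp
  rw [measureReal_def, hbox, erdosRenyi, Measure.pi_pi, Finset.prod_congr rfl fun e _ => hval e,
    Finset.prod_ite, Finset.prod_const, Finset.prod_const_one, mul_one, ENNReal.toReal_pow,
    ENNReal.toReal_ofReal h0, Set.ncard_eq_toFinset_card']
  congr 2
  ext e
  simp

theorem pow_mul_le_of_two_le {n a b : ℕ} {q : ℝ} (hn : 1 ≤ n) (h0 : 0 ≤ q) (h1 : q ≤ 1)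
    (ha : 2 ≤ a) (hb : 2 ≤ b) :
    q ^ (a * b) ≤ (n : ℝ) ^ 3 * ((1 / n : ℝ) ^ a * (q ^ 2) ^ b) +
      (n : ℝ) ^ 3 * ((q ^ 2) ^ a * (1 / n : ℝ) ^ b) + (q ^ 2) ^ a * (q ^ 2) ^ b := by
  have hn' : (1 : ℝ) ≤ n := by exact_mod_cast hn
  have hsmall : ∀ k l : ℕ, 2 ≤ k → k ≤ 3 →
      q ^ (k * l) ≤ (n : ℝ) ^ 3 * ((1 / n : ℝ) ^ k * (q ^ 2) ^ l) := by
    intro k l hk hk3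
    have hcoef : 1 ≤ (n : ℝ) ^ 3 * (1 / n : ℝ) ^ k := by
      rw [one_div, inv_pow, ← div_eq_mul_inv, one_le_div (by positivity)]
      exact pow_le_pow_right₀ hn' hk3
    calc q ^ (k * l) ≤ (q ^ 2) ^ l := by
          rw [← pow_mul]
          exact pow_le_pow_of_le_one h0 h1 (Nat.mul_le_mul_right l hk)
      _ ≤ ((n : ℝ) ^ 3 * (1 / n : ℝ) ^ k) * (q ^ 2) ^ l :=
          le_mul_of_one_le_left (by positivity) hcoef
      _ = _ := by ring
  have t1 : 0 ≤ (n : ℝ) ^ 3 * ((1 / n : ℝ) ^ a * (q ^ 2) ^ b) := by positivity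
  have t2 : 0 ≤ (n : ℝ) ^ 3 * ((q ^ 2) ^ a * (1 / n : ℝ) ^ b) := by positivity
  have t3 : 0 ≤ (q ^ 2) ^ a * (q ^ 2) ^ b := by positivity
  rcases Nat.lt_or_ge 3 a with ha3 | ha3
  · rcases Nat.lt_or_ge 3 b with hb3 | hb3
    · have : q ^ (a * b) ≤ (q ^ 2) ^ a * (q ^ 2) ^ b := by
        rw [← pow_add, ← pow_mul]
        exact pow_le_pow_of_le_one h0 h1 (by nlinarith)
      linarith
    · have := hsmall b a hb hb3
      rw [mul_comm b a, mul_comm ((1 / n : ℝ) ^ b)] at this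
      linarith
  · linarith [hsmall a b ha ha3]

theorem sum_pow_card_finset (n : ℕ) (x : ℝ) :
    ∑ A : Finset (Fin n), x ^ A.card = (1 + x) ^ n := by
  simpa [add_comm] using Fin.sum_pow_mul_eq_add_pow (n := n) x 1

/-- The generating function of nontrivial bicliques on `n` vertices by number of edges. -/
theorem sum_pow_card_mul_card_le {n : ℕ} {q : ℝ} (hn : 1 ≤ n) (h0 : 0 ≤ q) (h1 : q ≤ 1) :
    ∑ x : Finset (Fin n) × Finset (Fin n) with 2 ≤ x.1.card ∧ 2 ≤ x.2.card,
      q ^ (x.1.card * x.2.card) ≤ 7 * (n : ℝ) ^ 3 * (1 + q ^ 2) ^ (2 * n) := by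
  have hn' : (1 : ℝ) ≤ n := by exact_mod_cast hn
  have hprod : ∀ x y : ℝ, ∑ z : Finset (Fin n) × Finset (Fin n), x ^ z.1.card * y ^ z.2.card =
      (1 + x) ^ n * (1 + y) ^ n := by
    intro x y
    rw [← sum_pow_card_finset, ← sum_pow_card_finset, Finset.sum_mul_sum, Fintype.sum_prod_type]
  have hexp : (1 + 1 / n : ℝ) ^ n ≤ 3 := by
    calc (1 + 1 / n : ℝ) ^ n ≤ Real.exp (1 / n) ^ n := by
          gcongr
          linarith [Real.add_one_le_exp (1 / n : ℝ)]
      _ = Real.exp 1 := by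
          rw [← Real.exp_nat_mul]
          congr 1
          field_simp
      _ ≤ 3 := by linarith [Real.exp_one_lt_d9]
  set r : ℝ := (1 + q ^ 2) ^ n with hr
  have hr1 : 1 ≤ r := one_le_pow₀ (by nlinarith)
  have hn3 : (1 : ℝ) ≤ (n : ℝ) ^ 3 := one_le_pow₀ hn'
  calc _ ≤ ∑ x : Finset (Fin n) × Finset (Fin n) with 2 ≤ x.1.card ∧ 2 ≤ x.2.card,
        ((n : ℝ) ^ 3 * ((1 / n : ℝ) ^ x.1.card * (q ^ 2) ^ x.2.card) +
          (n : ℝ) ^ 3 * ((q ^ 2) ^ x.1.card * (1 / n : ℝ) ^ x.2.card) +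
          (q ^ 2) ^ x.1.card * (q ^ 2) ^ x.2.card) := by
        refine Finset.sum_le_sum fun x hx => ?_
        rw [Finset.mem_filter] at hx
        exact pow_mul_le_of_two_le hn h0 h1 hx.2.1 hx.2.2
    _ ≤ ∑ x : Finset (Fin n) × Finset (Fin n),
        ((n : ℝ) ^ 3 * ((1 / n : ℝ) ^ x.1.card * (q ^ 2) ^ x.2.card) +
          (n : ℝ) ^ 3 * ((q ^ 2) ^ x.1.card * (1 / n : ℝ) ^ x.2.card) +
          (q ^ 2) ^ x.1.card * (q ^ 2) ^ x.2.card) :=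
        Finset.sum_le_sum_of_subset_of_nonneg (Finset.filter_subset _ _)
          fun x _ _ => by positivity
    _ = 2 * (n : ℝ) ^ 3 * (1 + 1 / n : ℝ) ^ n * r + r * r := by
        rw [Finset.sum_add_distrib, Finset.sum_add_distrib, ← Finset.mul_sum, ← Finset.mul_sum,
          hprod, hprod, hprod, ← hr]
        ring
    _ ≤ 2 * (n : ℝ) ^ 3 * 3 * (r * r) + (n : ℝ) ^ 3 * (r * r) := by
        refine add_le_add ?_ (le_mul_of_one_le_left (mul_self_nonneg r) hn3)
        gcongr
        exact le_mul_of_one_le_left (by linarith) hr1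
    _ = _ := by
        rw [pow_mul', sq ((1 + q ^ 2) ^ n)]
        ring

/-- The event that `G(n,p)` contains at most `m` pairwise edge-disjoint nontrivial bicliques
covering at least `s` edges. -/
def coverEvent (n m : ℕ) (s : ℝ) : Set (Sym2 (Fin n) → Bool) :=
  {ω | ∃ t : ℕ, t ≤ m ∧ ∃ P : Fin t → Finset (Fin n) × Finset (Fin n),
    (∀ i, IsNontrivialBicliqueIn (graphOf n ω) (P i).1 (P i).2) ∧
    (∀ i j, i ≠ j → Disjoint (bicliqueEdges (P i).1 (P i).2)
      (bicliqueEdges (P j).1 (P j).2)) ∧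
    s ≤ ((⋃ i, bicliqueEdges (P i).1 (P i).2).ncard : ℝ)}

/-- Union bound over all families of bicliques, with `p = q ^ 2`. -/
theorem erdosRenyi_real_coverEvent_le {n m : ℕ} {q s : ℝ} (hn : 1 ≤ n) (h0 : 0 < q) (h1 : q ≤ 1) :
    (erdosRenyi n (q ^ 2)).real (coverEvent n m s) ≤
      (m + 1) * (7 * (n : ℝ) ^ 3 * (1 + q ^ 2) ^ (2 * n)) ^ m * q ^ s := by
  classical
  have : IsFiniteMeasure (erdosRenyi n (q ^ 2)) := by unfold erdosRenyi; infer_instance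
  let Q : Finset (Finset (Fin n) × Finset (Fin n)) := {x | 2 ≤ x.1.card ∧ 2 ≤ x.2.card}
  let U : (t : ℕ) → (Fin t → Finset (Fin n) × Finset (Fin n)) → Set (Sym2 (Fin n)) :=
    fun t P => ⋃ i, bicliqueEdges (P i).1 (P i).2
  let good : (t : ℕ) → Finset (Fin t → Finset (Fin n) × Finset (Fin n)) := fun t =>
    {P ∈ Fintype.piFinset fun _ => Q | s ≤ ((U t P).ncard : ℝ) ∧
      (U t P).ncard = ∑ i, (P i).1.card * (P i).2.card}
  set S : ℝ := 7 * (n : ℝ) ^ 3 * (1 + q ^ 2) ^ (2 * n)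
  have hS1 : 1 ≤ S := by
    have hn' : (1 : ℝ) ≤ n := by exact_mod_cast hn
    have ha : (1 : ℝ) ≤ (n : ℝ) ^ 3 := one_le_pow₀ hn'
    have hb : (1 : ℝ) ≤ (1 + q ^ 2) ^ (2 * n) := one_le_pow₀ (by nlinarith)
    nlinarith
  have hsub : coverEvent n m s ⊆ ⋃ t ∈ Finset.range (m + 1), ⋃ P ∈ good t,
      {ω | ∀ e ∈ U t P, ω e = true} := by
    rintro ω ⟨t, ht, P, hP, hdisj, hs⟩
    simp only [Set.mem_iUnion]
    refine ⟨t, Finset.mem_range.2 (by omega), P, ?_, ?_⟩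
    · refine Finset.mem_filter.2 ⟨Fintype.mem_piFinset.2 fun i => ?_, hs, ?_⟩
      · exact Finset.mem_filter.2 ⟨Finset.mem_univ _, (hP i).1, (hP i).2.1⟩
      · change (⋃ i, bicliqueEdges (P i).1 (P i).2).ncard = _
        rw [Set.ncard_iUnion_of_finite (fun i => Set.toFinite _) (fun i j hij => hdisj i j hij),
          finsum_eq_sum_of_fintype]
        exact Finset.sum_congr rfl fun i _ => ncard_bicliqueEdges (hP i).2.2.1
    · intro e he
      obtain ⟨i, a, ha, b, hb, rfl⟩ := Set.mem_iUnion.1 he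
      have hadj := (hP i).2.2.2 a ha b hb
      rw [graphOf, SimpleGraph.fromEdgeSet_adj] at hadj
      exact hadj.1
  have hterm : ∀ t, ∀ P ∈ good t, (erdosRenyi n (q ^ 2)).real {ω | ∀ e ∈ U t P, ω e = true} ≤
      q ^ s * ∏ i, q ^ ((P i).1.card * (P i).2.card) := by
    intro t P hP
    obtain ⟨-, hs, hcard⟩ := Finset.mem_filter.1 hP
    rw [erdosRenyi_real_forall_mem (by positivity) (by nlinarith), Finset.prod_pow_eq_pow_sum,
      ← hcard, ← pow_mul, two_mul, pow_add]
    gcongr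
    rw [← Real.rpow_natCast]
    exact Real.rpow_le_rpow_of_exponent_ge h0 h1 hs
  have hfixed : ∀ t ∈ Finset.range (m + 1),
      (erdosRenyi n (q ^ 2)).real (⋃ P ∈ good t, {ω | ∀ e ∈ U t P, ω e = true}) ≤
        S ^ m * q ^ s := by
    intro t ht
    calc _ ≤ ∑ P ∈ good t, q ^ s * ∏ i, q ^ ((P i).1.card * (P i).2.card) :=
          (measureReal_biUnion_finset_le _ _).trans (Finset.sum_le_sum (hterm t))
      _ ≤ ∑ P ∈ Fintype.piFinset fun _ : Fin t => Q,
          q ^ s * ∏ i, q ^ ((P i).1.card * (P i).2.card) :=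
          Finset.sum_le_sum_of_subset_of_nonneg (Finset.filter_subset _ _)
            fun _ _ _ => by positivity
      _ = q ^ s * (∑ x ∈ Q, q ^ (x.1.card * x.2.card)) ^ t := by
          rw [← Finset.mul_sum, Finset.sum_prod_piFinset Q
            (fun _ x => q ^ (x.1.card * x.2.card))]
          simp
      _ ≤ q ^ s * S ^ t := by
          gcongr
          exact sum_pow_card_mul_card_le hn h0.le h1
      _ ≤ q ^ s * S ^ m := by
          have := Finset.mem_range.1 ht
          gcongr
          omega
      _ = _ := mul_comm _ _
  calc _ ≤ _ := measureReal_mono hsub (measure_ne_top _ _)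
    _ ≤ _ := measureReal_biUnion_finset_le _ _
    _ ≤ _ := Finset.sum_le_sum hfixed
    _ = _ := by
      rw [Finset.sum_const, Finset.card_range, nsmul_eq_mul]
      push_cast
      ring

theorem union_bound_le_exp {n : ℕ} {p : ℝ} (hn : 7 ≤ n) (hp : 0 < p)
    (hlog : Real.log n ≤ n * p) (hpc : 224 ≤ Real.log (1 / p)) :
    (((2 * n : ℕ) : ℝ) + 1) * (7 * (n : ℝ) ^ 3 * (1 + p) ^ (2 * n)) ^ (2 * n) *
      √p ^ (p * n ^ 2 / 4) ≤ Real.exp (-(1 / 16 * p * Real.log (1 / p) * n ^ 2)) := by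
  have hn' : (7 : ℝ) ≤ n := by exact_mod_cast hn
  have hn0 : (0 : ℝ) < n := by linarith
  have hexp_log : Real.exp (Real.log n) = n := Real.exp_log hn0
  have hfirst : ((2 * n : ℕ) : ℝ) + 1 ≤ Real.exp (2 * Real.log n) := by
    rw [two_mul (Real.log n), Real.exp_add, hexp_log]
    push_cast
    nlinarith
  have hbase : 7 * (n : ℝ) ^ 3 * (1 + p) ^ (2 * n) ≤
      Real.exp (4 * Real.log n + 2 * n * p) := by
    have ha : 7 * (n : ℝ) ^ 3 ≤ Real.exp (4 * Real.log n) := by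
      have : Real.exp (4 * Real.log n) = (n : ℝ) ^ 4 := by
        rw [← hexp_log, ← Real.exp_nat_mul, Real.log_exp]
        norm_num
      rw [this, pow_succ' _ 3]
      gcongr
    have hb : (1 + p) ^ (2 * n) ≤ Real.exp (2 * n * p) := by
      calc (1 + p) ^ (2 * n) ≤ Real.exp p ^ (2 * n) := by
            gcongr
            linarith [Real.add_one_le_exp p]
        _ = _ := by
            rw [← Real.exp_nat_mul]
            push_cast
            rfl
    rw [Real.exp_add]
    gcongr
  have hlast : √p ^ (p * n ^ 2 / 4) = Real.exp (-(p * n ^ 2 / 8 * Real.log (1 / p))) := by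
    rw [Real.rpow_def_of_pos (Real.sqrt_pos.2 hp), Real.log_sqrt hp.le, one_div, Real.log_inv]
    congr 1
    ring
  calc _ ≤ Real.exp (2 * Real.log n) * Real.exp (4 * Real.log n + 2 * n * p) ^ (2 * n) *
        Real.exp (-(p * n ^ 2 / 8 * Real.log (1 / p))) := by
        rw [hlast]
        gcongr
    _ = Real.exp (2 * Real.log n + (2 * n) * (4 * Real.log n + 2 * n * p) -
        p * n ^ 2 / 8 * Real.log (1 / p)) := by
        rw [← Real.exp_nat_mul, ← Real.exp_add, ← Real.exp_add]
        push_cast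
        congr 1
    _ ≤ _ := by
        rw [Real.exp_le_exp]
        have hlog0 : 0 ≤ Real.log n := Real.log_nonneg (by linarith)
        have h1 : n * Real.log n ≤ n * (n * p) := by gcongr
        have h2 : Real.log n ≤ n * Real.log n := le_mul_of_one_le_left hlog0 (by linarith)
        have h3 : p * n ^ 2 * 224 ≤ p * n ^ 2 * Real.log (1 / p) := by gcongr
        nlinarith

/-- Lemma 3.2: for suitable absolute constants `a, c, C`, for large `n` and
`p ≤ c` with `np ≥ C log₂ n`, the probability that `G(n,p)` contains at most `2n` pairwise
edge-disjoint nontrivial complete bipartite subgraphs covering at least `pn²/4` edges is at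
most `2^{-a·p·log₂(1/p)·n²}`. -/
theorem nontrivial_cover_unlikely :
    ∃ a c C : ℝ, 0 < a ∧ 0 < c ∧ 0 < C ∧ ∃ N : ℕ, ∀ n : ℕ, N ≤ n →
      ∀ p : ℝ, 0 < p → p ≤ c → C * Real.logb 2 n ≤ n * p →
      erdosRenyi n p {ω | ∃ t : ℕ, t ≤ 2 * n ∧
          ∃ P : Fin t → Finset (Fin n) × Finset (Fin n),
            (∀ i, IsNontrivialBicliqueIn (graphOf n ω) (P i).1 (P i).2) ∧
            (∀ i j, i ≠ j → Disjoint (bicliqueEdges (P i).1 (P i).2)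
              (bicliqueEdges (P j).1 (P j).2)) ∧
            p * n ^ 2 / 4 ≤ ((⋃ i, bicliqueEdges (P i).1 (P i).2).ncard : ℝ)} ≤
        ENNReal.ofReal ((2 : ℝ) ^ (-(a * p * Real.logb 2 (1 / p) * n ^ 2))) := by
  refine ⟨1 / 16, Real.exp (-224), 1, by norm_num, Real.exp_pos _, one_pos, 7, ?_⟩
  intro n hn p hp hpc hlogb
  have hn' : (7 : ℝ) ≤ n := by exact_mod_cast hn
  have hlog2 : 0 < Real.log 2 := Real.log_pos one_lt_two
  have hlog : Real.log n ≤ n * p := by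
    refine le_trans ?_ hlogb
    rw [one_mul, Real.logb, le_div_iff₀ hlog2]
    exact mul_le_of_le_one_right (Real.log_nonneg (by linarith))
      (by linarith [Real.log_two_lt_d9])
  have hL : 224 ≤ Real.log (1 / p) := by
    rw [one_div, Real.log_inv]
    linarith [(Real.log_le_iff_le_exp hp).2 hpc]
  have hp1 : p ≤ 1 := hpc.trans (Real.exp_le_one_iff.2 (by norm_num))
  have hbound := erdosRenyi_real_coverEvent_le (n := n) (m := 2 * n) (s := p * n ^ 2 / 4)
    (by omega) (Real.sqrt_pos.2 hp) (Real.sqrt_le_one.2 hp1)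
  rw [Real.sq_sqrt hp.le] at hbound
  have : IsFiniteMeasure (erdosRenyi n p) := by unfold erdosRenyi; infer_instance
  change erdosRenyi n p (coverEvent n (2 * n) (p * n ^ 2 / 4)) ≤ _
  rw [← ofReal_measureReal]
  refine ENNReal.ofReal_le_ofReal
    ((hbound.trans (union_bound_le_exp hn hp hlog hL)).trans_eq ?_)
  rw [Real.rpow_def_of_pos two_pos, Real.logb]
  congr 1
  field_simp

end RandomBipartiteDecomposition
end
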